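/- arXiv:2501.17019 — 2 statements merged into one kernel-verified Lean document; each statement's English description precedes it below -/
import Mathlib

section
/- (i) If Ω₀ equals the closure of its interior and there exists ξ₀ ∈ Ω₀ with v(ξ₀) = 0 for all v ∈ S, then E_wc : L²(Ω₀, μ) → ℝ is not coercive. (ii) If there exists a finite or countable subset S₀ ⊆ S such that for every ξ ∈ Ω₀ there is h ∈ S₀ with h(ξ) ≠ 0, then E_wc : L²(Ω₀, μ) → ℝ is coercive; in fact there exist constants c, C > 0 such that E_wc(m) ≥ c·‖m‖²_{L²(Ω₀,μ)} − C for every m ∈ L²(Ω₀, μ). -/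
open MeasureTheory Set Pointwise Filter Topology
open scoped Classical ENNReal

noncomputable section

variable {d : ℕ} {α : ℝ} {Ω₀ : Set (EuclideanSpace ℝ (Fin d))}

def vLow (v : C(↥(Ω₀ ∪ α • Ω₀), ℂ)) (ξ : EuclideanSpace ℝ (Fin d)) : ℂ :=
  if h : ξ ∈ Ω₀ then v ⟨ξ, Or.inl h⟩ else 0

def vHigh (v : C(↥(Ω₀ ∪ α • Ω₀), ℂ)) (ξ : EuclideanSpace ℝ (Fin d)) : ℂ :=
  if h : ξ ∈ Ω₀ then v ⟨α • ξ, Or.inr (smul_mem_smul_set h)⟩ else 0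

def Eapp (μ : Measure (EuclideanSpace ℝ (Fin d)))
    (v : C(↥(Ω₀ ∪ α • Ω₀), ℂ)) (m : Lp ℂ 2 (μ.restrict Ω₀)) : ℝ :=
  (1 / 2) * ∫ ξ in Ω₀, ‖vHigh v ξ - m ξ * vLow v ξ‖ ^ 2 ∂μ

def Ewc (μ : Measure (EuclideanSpace ℝ (Fin d))) (S : Set C(↥(Ω₀ ∪ α • Ω₀), ℂ))
    (m : Lp ℂ 2 (μ.restrict Ω₀)) : ℝ :=
  sSup ((fun v => Eapp μ v m) '' S)

lemma norm_vLow_le [CompactSpace ↥(Ω₀ ∪ α • Ω₀)] (v : C(↥(Ω₀ ∪ α • Ω₀), ℂ))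
    (ξ : EuclideanSpace ℝ (Fin d)) : ‖vLow v ξ‖ ≤ ‖v‖ := by
  unfold vLow
  split_ifs
  · exact v.norm_coe_le_norm _
  · simp

lemma norm_vHigh_le [CompactSpace ↥(Ω₀ ∪ α • Ω₀)] (v : C(↥(Ω₀ ∪ α • Ω₀), ℂ))
    (ξ : EuclideanSpace ℝ (Fin d)) : ‖vHigh v ξ‖ ≤ ‖v‖ := by
  unfold vHigh
  split_ifs
  · exact v.norm_coe_le_norm _
  · simp

lemma continuousOn_vLow (v : C(↥(Ω₀ ∪ α • Ω₀), ℂ)) : ContinuousOn (vLow v) Ω₀ := by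
  rw [continuousOn_iff_continuous_domRestrict]
  have h : Ω₀.domRestrict (vLow v) = fun x : Ω₀ => v ⟨x, Or.inl x.2⟩ := by
    ext x
    simp [vLow]
  rw [h]
  fun_prop

lemma continuousOn_vHigh (v : C(↥(Ω₀ ∪ α • Ω₀), ℂ)) : ContinuousOn (vHigh v) Ω₀ := by
  rw [continuousOn_iff_continuous_domRestrict]
  have h : Ω₀.domRestrict (vHigh v) =
      fun x : Ω₀ => v ⟨α • x, Or.inr (smul_mem_smul_set x.2)⟩ := by
    ext x
    simp [vHigh]
  rw [h]
  fun_prop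

lemma memLp_vHigh [CompactSpace ↥(Ω₀ ∪ α • Ω₀)] (hΩ₀ : IsCompact Ω₀)
    (μ : Measure (EuclideanSpace ℝ (Fin d))) [IsFiniteMeasure μ]
    (v : C(↥(Ω₀ ∪ α • Ω₀), ℂ)) : MemLp (vHigh v) 2 (μ.restrict Ω₀) :=
  MemLp.of_bound ((continuousOn_vHigh v).aestronglyMeasurable hΩ₀.measurableSet) ‖v‖
    (Eventually.of_forall (norm_vHigh_le v))

lemma memLp_mul_vLow [CompactSpace ↥(Ω₀ ∪ α • Ω₀)] (hΩ₀ : IsCompact Ω₀)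
    (μ : Measure (EuclideanSpace ℝ (Fin d)))
    (v : C(↥(Ω₀ ∪ α • Ω₀), ℂ)) (m : Lp ℂ 2 (μ.restrict Ω₀)) :
    MemLp (fun ξ => m ξ * vLow v ξ) 2 (μ.restrict Ω₀) := by
  refine (Lp.memLp m).of_le_mul (c := ‖v‖) ((Lp.aestronglyMeasurable m).mul
    ((continuousOn_vLow v).aestronglyMeasurable hΩ₀.measurableSet)) (Eventually.of_forall ?_)
  intro ξ
  rw [norm_mul, mul_comm]
  gcongr
  exact norm_vLow_le v ξ

lemma integral_norm_sq_eq_norm_sq {X : Type*} [MeasurableSpace X] {ν : Measure X}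
    (m : Lp ℂ 2 ν) : ∫ x, ‖m x‖ ^ 2 ∂ν = ‖m‖ ^ 2 := by
  have h : (inner ℂ m m : ℂ) = ((∫ x, ‖m x‖ ^ 2 ∂ν : ℝ) : ℂ) := by
    rw [L2.inner_def, ← integral_complex_ofReal]
    congr 1
    ext x
    rw [inner_self_eq_norm_sq_to_K]
    norm_cast
  rw [inner_self_eq_norm_sq_to_K] at h
  exact Complex.ofReal_injective (by rw [Complex.ofReal_pow]; exact h.symm)

lemma norm_sub_sq_le_two_mul {E : Type*} [SeminormedAddCommGroup E] (a b : E) :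
    ‖a - b‖ ^ 2 ≤ 2 * ‖a‖ ^ 2 + 2 * ‖b‖ ^ 2 := by
  nlinarith [norm_sub_le a b, norm_nonneg (a - b), sq_nonneg (‖a‖ - ‖b‖)]

lemma Eapp_nonneg (μ : Measure (EuclideanSpace ℝ (Fin d)))
    (v : C(↥(Ω₀ ∪ α • Ω₀), ℂ)) (m : Lp ℂ 2 (μ.restrict Ω₀)) : 0 ≤ Eapp μ v m :=
  mul_nonneg (by norm_num) (integral_nonneg fun _ => by positivity)

lemma integral_norm_vHigh_sq_le [CompactSpace ↥(Ω₀ ∪ α • Ω₀)] (hΩ₀ : IsCompact Ω₀)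
    (μ : Measure (EuclideanSpace ℝ (Fin d))) [IsFiniteMeasure μ]
    (v : C(↥(Ω₀ ∪ α • Ω₀), ℂ)) {R : ℝ} (hR : ‖v‖ ≤ R) :
    ∫ ξ in Ω₀, ‖vHigh v ξ‖ ^ 2 ∂μ ≤ R ^ 2 * μ.real Ω₀ := by
  calc ∫ ξ in Ω₀, ‖vHigh v ξ‖ ^ 2 ∂μ ≤ ∫ _ in Ω₀, R ^ 2 ∂μ := by
        refine integral_mono (memLp_vHigh hΩ₀ μ v).norm.integrable_sq (integrable_const _) ?_
        intro ξ
        exact pow_le_pow_left₀ (norm_nonneg _) ((norm_vHigh_le v ξ).trans hR) 2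
    _ = R ^ 2 * μ.real Ω₀ := by simp [mul_comm]

lemma Eapp_le [CompactSpace ↥(Ω₀ ∪ α • Ω₀)] (hΩ₀ : IsCompact Ω₀)
    (μ : Measure (EuclideanSpace ℝ (Fin d))) [IsFiniteMeasure μ]
    (v : C(↥(Ω₀ ∪ α • Ω₀), ℂ)) (m : Lp ℂ 2 (μ.restrict Ω₀)) {R ε : ℝ} (hR : ‖v‖ ≤ R)
    (hε : ∀ᵐ ξ ∂(μ.restrict Ω₀), ‖m ξ * vLow v ξ‖ ≤ ε * ‖m ξ‖) :
    Eapp μ v m ≤ R ^ 2 * μ.real Ω₀ + ε ^ 2 * ‖m‖ ^ 2 := by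
  have hH := (memLp_vHigh hΩ₀ μ v).norm.integrable_sq
  have hL := (memLp_mul_vLow hΩ₀ μ v m).norm.integrable_sq
  have hm := (Lp.memLp m).norm.integrable_sq
  have h₁ : ∫ ξ in Ω₀, ‖vHigh v ξ - m ξ * vLow v ξ‖ ^ 2 ∂μ ≤
      2 * ∫ ξ in Ω₀, ‖vHigh v ξ‖ ^ 2 ∂μ + 2 * ∫ ξ in Ω₀, ‖m ξ * vLow v ξ‖ ^ 2 ∂μ := by
    rw [← integral_const_mul, ← integral_const_mul,
      ← integral_add (hH.const_mul 2) (hL.const_mul 2)]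
    exact integral_mono ((memLp_vHigh hΩ₀ μ v).sub (memLp_mul_vLow hΩ₀ μ v m)).norm.integrable_sq
      ((hH.const_mul 2).add (hL.const_mul 2)) fun ξ => norm_sub_sq_le_two_mul _ _
  have h₂ : ∫ ξ in Ω₀, ‖m ξ * vLow v ξ‖ ^ 2 ∂μ ≤ ε ^ 2 * ‖m‖ ^ 2 := by
    rw [← integral_norm_sq_eq_norm_sq, ← integral_const_mul]
    refine integral_mono_ae hL (hm.const_mul _) ?_
    filter_upwards [hε] with ξ hξ
    rw [← mul_pow]
    exact pow_le_pow_left₀ (norm_nonneg _) hξ 2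
  have h₃ := integral_norm_vHigh_sq_le hΩ₀ μ v hR
  unfold Eapp
  linarith

lemma Eapp_ge [CompactSpace ↥(Ω₀ ∪ α • Ω₀)] (hΩ₀ : IsCompact Ω₀)
    (μ : Measure (EuclideanSpace ℝ (Fin d))) [IsFiniteMeasure μ]
    (v : C(↥(Ω₀ ∪ α • Ω₀), ℂ)) (m : Lp ℂ 2 (μ.restrict Ω₀)) {R : ℝ} (hR : ‖v‖ ≤ R) :
    (1 / 4) * ∫ ξ in Ω₀, ‖m ξ * vLow v ξ‖ ^ 2 ∂μ - R ^ 2 * μ.real Ω₀ ≤ Eapp μ v m := by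
  have hH := (memLp_vHigh hΩ₀ μ v).norm.integrable_sq
  have hD : Integrable (fun ξ => ‖vHigh v ξ - m ξ * vLow v ξ‖ ^ 2) (μ.restrict Ω₀) :=
    ((memLp_vHigh hΩ₀ μ v).sub (memLp_mul_vLow hΩ₀ μ v m)).norm.integrable_sq
  have h₁ : ∫ ξ in Ω₀, ‖m ξ * vLow v ξ‖ ^ 2 ∂μ ≤ 2 * ∫ ξ in Ω₀, ‖vHigh v ξ‖ ^ 2 ∂μ +
      2 * ∫ ξ in Ω₀, ‖vHigh v ξ - m ξ * vLow v ξ‖ ^ 2 ∂μ := by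
    rw [← integral_const_mul, ← integral_const_mul,
      ← integral_add (hH.const_mul 2) (hD.const_mul 2)]
    refine integral_mono (memLp_mul_vLow hΩ₀ μ v m).norm.integrable_sq
      ((hH.const_mul 2).add (hD.const_mul 2)) fun ξ => ?_
    simpa using norm_sub_sq_le_two_mul (vHigh v ξ) (vHigh v ξ - m ξ * vLow v ξ)
  have h₃ := integral_norm_vHigh_sq_le hΩ₀ μ v hR
  have h₄ : 0 ≤ R ^ 2 * μ.real Ω₀ := by positivity
  unfold Eapp
  linarith

lemma bddAbove_Eapp_image [CompactSpace ↥(Ω₀ ∪ α • Ω₀)] (hΩ₀ : IsCompact Ω₀)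
    (μ : Measure (EuclideanSpace ℝ (Fin d))) [IsFiniteMeasure μ]
    {S : Set C(↥(Ω₀ ∪ α • Ω₀), ℂ)} {R : ℝ} (hR : ∀ v ∈ S, ‖v‖ ≤ R)
    (m : Lp ℂ 2 (μ.restrict Ω₀)) : BddAbove ((fun v => Eapp μ v m) '' S) := by
  refine ⟨R ^ 2 * μ.real Ω₀ + R ^ 2 * ‖m‖ ^ 2, ?_⟩
  rintro _ ⟨v, hv, rfl⟩
  refine Eapp_le hΩ₀ μ v m (hR v hv) (Eventually.of_forall fun ξ => ?_)
  rw [norm_mul, mul_comm]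
  gcongr
  exact (norm_vLow_le v ξ).trans (hR v hv)

lemma exists_isOpen_norm_vLow_lt [CompactSpace ↥(Ω₀ ∪ α • Ω₀)]
    {S : Set C(↥(Ω₀ ∪ α • Ω₀), ℂ)} (hS : IsCompact S)
    {ξ₀ : EuclideanSpace ℝ (Fin d)} (h₀ : ξ₀ ∈ Ω₀)
    (hz : ∀ v ∈ S, v ⟨ξ₀, Or.inl h₀⟩ = 0) {ε : ℝ} (hε : 0 < ε) :
    ∃ U : Set (EuclideanSpace ℝ (Fin d)), IsOpen U ∧ ξ₀ ∈ U ∧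
      ∀ v ∈ S, ∀ ξ ∈ U, ‖vLow v ξ‖ < ε := by
  have hopen : IsOpen {p : C(↥(Ω₀ ∪ α • Ω₀), ℂ) × ↥(Ω₀ ∪ α • Ω₀) | ‖p.1 p.2‖ < ε} :=
    isOpen_lt (by fun_prop) continuous_const
  obtain ⟨V, W, -, hW, hSV, hξW, hVW⟩ := generalized_tube_lemma hS
    (isCompact_singleton (x := (⟨ξ₀, Or.inl h₀⟩ : ↥(Ω₀ ∪ α • Ω₀)))) hopen (by
      rintro ⟨v, x⟩ ⟨hv, hx⟩
      obtain rfl : x = ⟨ξ₀, Or.inl h₀⟩ := hx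
      simpa [hz v hv] using hε)
  obtain ⟨U, hU, rfl⟩ := isOpen_induced_iff.mp hW
  refine ⟨U, hU, hξW rfl, fun v hv ξ hξ => ?_⟩
  unfold vLow
  split_ifs with h
  · exact hVW (Set.mk_mem_prod (hSV hv) (show (⟨ξ, Or.inl h⟩ : ↥(Ω₀ ∪ α • Ω₀)) ∈ _ from hξ))
  · simpa using hε

lemma exists_norm_eq_Ewc_le [CompactSpace ↥(Ω₀ ∪ α • Ω₀)] (hΩ₀ : IsCompact Ω₀)
    (μ : Measure (EuclideanSpace ℝ (Fin d))) [IsFiniteMeasure μ]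
    (hμ : ∀ A : Set (EuclideanSpace ℝ (Fin d)), IsOpen A → A ⊆ Ω₀ → A.Nonempty → μ A ≠ 0)
    {S : Set C(↥(Ω₀ ∪ α • Ω₀), ℂ)} (hS : IsCompact S) (hSne : S.Nonempty)
    {R : ℝ} (hR : ∀ v ∈ S, ‖v‖ ≤ R)
    {ξ₀ : EuclideanSpace ℝ (Fin d)} (h₀ : ξ₀ ∈ Ω₀) (hcl : ξ₀ ∈ closure (interior Ω₀))
    (hz : ∀ v ∈ S, v ⟨ξ₀, Or.inl h₀⟩ = 0) {r : ℝ} (hr : 0 < r) :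
    ∃ m : Lp ℂ 2 (μ.restrict Ω₀), ‖m‖ = r ∧ Ewc μ S m ≤ R ^ 2 * μ.real Ω₀ + 1 := by
  obtain ⟨U, hU, hξU, hlt⟩ := exists_isOpen_norm_vLow_lt hS h₀ hz (inv_pos.mpr hr)
  have hBo : IsOpen (U ∩ interior Ω₀) := hU.inter isOpen_interior
  have hBs : U ∩ interior Ω₀ ⊆ Ω₀ := inter_subset_right.trans interior_subset
  have hB₀ : μ.restrict Ω₀ (U ∩ interior Ω₀) ≠ 0 := by
    rw [Measure.restrict_eq_self _ hBs]
    exact hμ _ hBo hBs (mem_closure_iff.mp hcl U hU hξU)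
  have hBfin : μ.restrict Ω₀ (U ∩ interior Ω₀) ≠ ⊤ := measure_ne_top _ _
  set t : ℝ := (μ.restrict Ω₀).real (U ∩ interior Ω₀) ^ (1 / (2 : ℝ≥0∞).toReal) with ht
  have htpos : 0 < t := Real.rpow_pos_of_pos (ENNReal.toReal_pos hB₀ hBfin) _
  let m := indicatorConstLp 2 hBo.measurableSet hBfin ((r / t : ℝ) : ℂ)
  have hm : ‖m‖ = r := by
    rw [norm_indicatorConstLp (by norm_num) (by norm_num), ← ht, Complex.norm_real,
      Real.norm_of_nonneg (by positivity)]
    field_simp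
  refine ⟨m, hm, csSup_le (hSne.image _) ?_⟩
  rintro _ ⟨v, hv, rfl⟩
  refine (Eapp_le hΩ₀ μ v m (ε := r⁻¹) (hR v hv) ?_).trans_eq ?_
  · filter_upwards [indicatorConstLp_coeFn (p := 2) (hs := hBo.measurableSet) (hμs := hBfin)
      (c := ((r / t : ℝ) : ℂ))] with ξ hξ
    by_cases hmem : ξ ∈ U ∩ interior Ω₀
    · rw [norm_mul, mul_comm]
      gcongr
      exact (hlt v hv ξ hmem.1).le
    · have : m ξ = 0 := by rw [hξ, indicator_of_notMem hmem]
      simp [this]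
  · rw [hm, ← mul_pow, inv_mul_cancel₀ hr.ne', one_pow]

lemma exists_finset_sum_norm_vLow_sq_ge (hΩ₀ : IsCompact Ω₀)
    {S₀ : Set C(↥(Ω₀ ∪ α • Ω₀), ℂ)}
    (hS₀ : ∀ ξ : EuclideanSpace ℝ (Fin d), ∀ hξ : ξ ∈ Ω₀, ∃ h ∈ S₀, h ⟨ξ, Or.inl hξ⟩ ≠ 0) :
    ∃ F : Finset C(↥(Ω₀ ∪ α • Ω₀), ℂ), ↑F ⊆ S₀ ∧ ∃ δ > (0 : ℝ), ∀ ξ ∈ Ω₀,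
      δ ≤ ∑ v ∈ F, ‖vLow v ξ‖ ^ 2 := by
  have hF : ∃ F : Finset C(↥(Ω₀ ∪ α • Ω₀), ℂ), ↑F ⊆ S₀ ∧ ∀ ξ ∈ Ω₀, ∃ v ∈ F, vLow v ξ ≠ 0 := by
    refine hΩ₀.induction_on (p := fun A => ∃ F : Finset C(↥(Ω₀ ∪ α • Ω₀), ℂ), ↑F ⊆ S₀ ∧
      ∀ ξ ∈ A, ∃ v ∈ F, vLow v ξ ≠ 0) ⟨∅, by simp, by simp⟩ ?_ ?_ ?_
    · rintro A B hAB ⟨F, hF, hB⟩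
      exact ⟨F, hF, fun ξ hξ => hB ξ (hAB hξ)⟩
    · rintro A B ⟨F, hF, hA⟩ ⟨G, hG, hB⟩
      refine ⟨F ∪ G, by simpa using ⟨hF, hG⟩, ?_⟩
      rintro ξ (hξ | hξ)
      · obtain ⟨v, hv, h⟩ := hA ξ hξ
        exact ⟨v, Finset.mem_union_left _ hv, h⟩
      · obtain ⟨v, hv, h⟩ := hB ξ hξ
        exact ⟨v, Finset.mem_union_right _ hv, h⟩
    · intro ξ hξ
      obtain ⟨v, hv, hne⟩ := hS₀ ξ hξ
      have hne' : vLow v ξ ≠ 0 := by simpa [vLow, hξ] using hne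
      exact ⟨{x | vLow v x ≠ 0}, (continuousOn_vLow v ξ hξ).eventually_ne hne', {v},
        by simpa using hv, fun x hx => ⟨v, by simp, hx⟩⟩
  obtain ⟨F, hFS, hF⟩ := hF
  have hcont : ContinuousOn (fun ξ => ∑ v ∈ F, ‖vLow v ξ‖ ^ 2) Ω₀ :=
    continuousOn_finsetSum _ fun v _ => (continuousOn_vLow v).norm.pow 2
  obtain ⟨δ, hδ, hle⟩ := hΩ₀.exists_forall_le' hcont (a := 0) fun ξ hξ => by
    obtain ⟨v, hv, hne⟩ := hF ξ hξ
    exact Finset.sum_pos' (fun _ _ => by positivity) ⟨v, hv, by positivity⟩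
  exact ⟨F, hFS, δ, hδ, hle⟩

lemma exists_mul_norm_sq_sub_le_Ewc [CompactSpace ↥(Ω₀ ∪ α • Ω₀)] (hΩ₀ : IsCompact Ω₀)
    (μ : Measure (EuclideanSpace ℝ (Fin d))) [IsFiniteMeasure μ]
    {S : Set C(↥(Ω₀ ∪ α • Ω₀), ℂ)} (hSne : S.Nonempty) {R : ℝ} (hR : ∀ v ∈ S, ‖v‖ ≤ R)
    {S₀ : Set C(↥(Ω₀ ∪ α • Ω₀), ℂ)} (hsub : S₀ ⊆ S)
    (hS₀ : ∀ ξ : EuclideanSpace ℝ (Fin d), ∀ hξ : ξ ∈ Ω₀, ∃ h ∈ S₀, h ⟨ξ, Or.inl hξ⟩ ≠ 0) :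
    ∃ c > (0 : ℝ), ∃ C > (0 : ℝ), ∀ m : Lp ℂ 2 (μ.restrict Ω₀),
      c * ‖m‖ ^ 2 - C ≤ Ewc μ S m := by
  obtain ⟨F, hFS, δ, hδ, hle⟩ := exists_finset_sum_norm_vLow_sq_ge hΩ₀ hS₀
  refine ⟨δ / 4 / (F.card + 1), by positivity, R ^ 2 * μ.real Ω₀ + 1, by positivity, fun m => ?_⟩
  have hE : ∀ v ∈ S, Eapp μ v m ≤ Ewc μ S m := fun v hv =>
    le_csSup (bddAbove_Eapp_image hΩ₀ μ hR m) ⟨v, hv, rfl⟩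
  have hE₀ : 0 ≤ Ewc μ S m := by
    obtain ⟨v, hv⟩ := hSne
    exact (Eapp_nonneg μ v m).trans (hE v hv)
  have hsum : ∑ v ∈ F, ((1 / 4) * ∫ ξ in Ω₀, ‖m ξ * vLow v ξ‖ ^ 2 ∂μ - R ^ 2 * μ.real Ω₀) ≤
      ∑ _v ∈ F, Ewc μ S m := Finset.sum_le_sum fun v hv =>
    (Eapp_ge hΩ₀ μ v m (hR v (hsub (hFS hv)))).trans (hE v (hsub (hFS hv)))
  have hint : δ * ‖m‖ ^ 2 ≤ ∑ v ∈ F, ∫ ξ in Ω₀, ‖m ξ * vLow v ξ‖ ^ 2 ∂μ := by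
    have hL := fun v : C(↥(Ω₀ ∪ α • Ω₀), ℂ) => (memLp_mul_vLow hΩ₀ μ v m).norm.integrable_sq
    rw [← integral_norm_sq_eq_norm_sq, ← integral_const_mul,
      ← integral_finsetSum _ fun v _ => hL v]
    refine integral_mono_ae ((Lp.memLp m).norm.integrable_sq.const_mul _)
      (integrable_finsetSum _ fun v _ => hL v) ?_
    filter_upwards [ae_restrict_mem hΩ₀.measurableSet] with ξ hξ
    simp only [norm_mul, mul_pow, ← Finset.mul_sum]
    rw [mul_comm]
    gcongr
    exact hle ξ hξ
  rw [Finset.sum_sub_distrib, ← Finset.mul_sum, Finset.sum_const, Finset.sum_const,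
    nsmul_eq_mul, nsmul_eq_mul] at hsum
  have hC : 0 ≤ R ^ 2 * μ.real Ω₀ := by positivity
  rw [div_mul_eq_mul_div, sub_le_iff_le_add, div_le_iff₀ (by positivity)]
  nlinarith [(Nat.cast_nonneg F.card : (0 : ℝ) ≤ F.card)]

/-- (i) If the elements of `S` have a common zero on `Ω₀` (and `Ω₀` is the
closure of its interior) then `E_wc : L²(Ω₀, μ) → ℝ` is not coercive.  (ii) If some countable
subset `S₀ ⊆ S` has no common zero on `Ω₀` then `E_wc` is coercive; in fact
`E_wc(m) ≥ c‖m‖² − C` for some constants `c, C > 0`. -/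
theorem stmt3 (hd : 1 ≤ d) (hα : 1 < α) (hΩ₀ : IsCompact Ω₀)
    [CompactSpace ↥(Ω₀ ∪ α • Ω₀)]
    (μ : Measure (EuclideanSpace ℝ (Fin d))) [IsFiniteMeasure μ]
    (cμ Cμ : ℝ≥0∞) (hcμ : 0 < cμ) (hcC : cμ ≤ Cμ) (hCμ : Cμ ≠ ⊤)
    (hcomp : ∀ A : Set (EuclideanSpace ℝ (Fin d)), MeasurableSet A → A ⊆ Ω₀ →
      cμ * volume A ≤ μ A ∧ μ A ≤ Cμ * volume A)
    (S : Set C(↥(Ω₀ ∪ α • Ω₀), ℂ)) (hS : IsCompact S) (hSne : S.Nonempty) :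
    -- (i) not coercive in the presence of a common zero
    ((Ω₀ = closure (interior Ω₀)) →
      (∃ ξ₀ : EuclideanSpace ℝ (Fin d), ∃ h₀ : ξ₀ ∈ Ω₀, ∀ v ∈ S, v ⟨ξ₀, Or.inl h₀⟩ = 0) →
      ∃ mseq : ℕ → Lp ℂ 2 (μ.restrict Ω₀),
        Tendsto (fun k => ‖mseq k‖) atTop atTop ∧
        ¬ Tendsto (fun k => Ewc μ S (mseq k)) atTop atTop) ∧
    -- (ii) coercive when a countable subset of `S` has no common zero
    ((∃ S₀ : Set C(↥(Ω₀ ∪ α • Ω₀), ℂ), S₀ ⊆ S ∧ S₀.Countable ∧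
        ∀ ξ : EuclideanSpace ℝ (Fin d), ∀ hξ : ξ ∈ Ω₀, ∃ h ∈ S₀, h ⟨ξ, Or.inl hξ⟩ ≠ 0) →
      ((∀ mseq : ℕ → Lp ℂ 2 (μ.restrict Ω₀),
          Tendsto (fun k => ‖mseq k‖) atTop atTop →
          Tendsto (fun k => Ewc μ S (mseq k)) atTop atTop) ∧
        ∃ c > (0 : ℝ), ∃ C > (0 : ℝ), ∀ m : Lp ℂ 2 (μ.restrict Ω₀),
          c * ‖m‖ ^ 2 - C ≤ Ewc μ S m)) := by
  obtain ⟨R, hR⟩ := hS.isBounded.exists_norm_le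
  refine ⟨fun hreg ⟨ξ₀, h₀, hz⟩ => ?_, fun ⟨S₀, hsub, _, hS₀⟩ => ?_⟩
  · have hμ : ∀ A : Set (EuclideanSpace ℝ (Fin d)), IsOpen A → A ⊆ Ω₀ → A.Nonempty →
        μ A ≠ 0 := fun A hA hAs hne hzero => by
      have hvol := (hcomp A hA.measurableSet hAs).1
      rw [hzero, nonpos_iff_eq_zero, mul_eq_zero] at hvol
      exact hvol.elim hcμ.ne' (hA.measure_pos volume hne).ne'
    have hex (k : ℕ) := exists_norm_eq_Ewc_le hΩ₀ μ hμ hS hSne hR h₀ (hreg ▸ h₀) hz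
      (show (0 : ℝ) < k + 1 by positivity)
    choose mseq hnorm hbound using hex
    refine ⟨mseq, ?_, fun htend => ?_⟩
    · simp only [hnorm]
      exact tendsto_atTop_add_const_right _ _ tendsto_natCast_atTop_atTop
    · obtain ⟨k, hk⟩ := (htend.eventually_gt_atTop (R ^ 2 * μ.real Ω₀ + 1)).exists
      exact (hbound k).not_gt hk
  · obtain ⟨c, hc, C, hC, hle⟩ := exists_mul_norm_sq_sub_le_Ewc hΩ₀ μ hSne hR hsub hS₀
    refine ⟨fun mseq hm => ?_, c, hc, C, hC, hle⟩
    refine tendsto_atTop_mono (fun k => hle (mseq k)) ?_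
    exact tendsto_atTop_add_const_right _ (-C)
      (((tendsto_pow_atTop two_ne_zero).comp hm).const_mul_atTop hc)
end
end

section
/- Let W ⊂ H be nonempty, compact, convex, invariant under unitary conjugation (U*·X·U ∈ W for all unitary U and X ∈ W), and such that W = { U·diag(d)·U* : U unitary, d ∈ D_W } for some convex, permutation-invariant, orthosymmetric set D_W ⊆ ℝⁿ. If X is a Hermitian positive semidefinite n×n matrix, then the nearest-point projection of X onto W in H is positive semidefinite. -/
open Set Matrix
open scoped ComplexOrder

attribute [local instance] Matrix.frobeniusNormedAddCommGroup Matrix.frobeniusNormedSpace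

noncomputable section

/-- The squared Frobenius norm is the sum of the squared norms of the entries. -/
lemma frobenius_norm_sq {n : ℕ} (A : Matrix (Fin n) (Fin n) ℂ) :
    ‖A‖ ^ 2 = ∑ i, ∑ j, ‖A i j‖ ^ 2 := by
  rw [Matrix.frobenius_norm_def, ← Real.sqrt_eq_rpow, Real.sq_sqrt (by positivity)]
  simp

lemma frobenius_norm_sq_eq_trace {n : ℕ} (A : Matrix (Fin n) (Fin n) ℂ) :
    ((‖A‖ ^ 2 : ℝ) : ℂ) = (star A * A).trace := by
  rw [frobenius_norm_sq, Finset.sum_comm]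
  simp [Matrix.trace, Matrix.mul_apply, Matrix.star_apply, Complex.conj_mul']

/-- The Frobenius norm is invariant under unitary conjugation. -/
lemma frobenius_norm_unitary_conj {n : ℕ} {U : Matrix (Fin n) (Fin n) ℂ}
    (hU : U ∈ Matrix.unitaryGroup (Fin n) ℂ) (A : Matrix (Fin n) (Fin n) ℂ) :
    ‖star U * A * U‖ = ‖A‖ := by
  have hUU : U * star U = 1 := Matrix.mem_unitaryGroup_iff.1 hU
  have h : star (star U * A * U) * (star U * A * U) = star U * (star A * A * U) := by
    calc _ = star U * (star A * (U * star U) * A * U) := by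
          simp only [star_mul, star_star, mul_assoc]
      _ = _ := by rw [hUU, mul_one]
  have hsq : ‖star U * A * U‖ ^ 2 = ‖A‖ ^ 2 := by
    apply Complex.ofReal_injective
    rw [frobenius_norm_sq_eq_trace, frobenius_norm_sq_eq_trace, h, Matrix.trace_mul_comm,
      mul_assoc, hUU, mul_one]
  exact (sq_eq_sq₀ (norm_nonneg _) (norm_nonneg _)).1 hsq

/-- A convex orthosymmetric set is stable under setting one coordinate to zero. -/
lemma update_zero_mem_of_orthosymmetric {n : ℕ} {D : Set (Fin n → ℝ)} (hconv : Convex ℝ D)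
    (hsign : ∀ x ∈ D, ∀ s : Fin n → ℝ, (∀ i, s i = 1 ∨ s i = -1) → (fun i => s i * x i) ∈ D)
    {x : Fin n → ℝ} (hx : x ∈ D) (k : Fin n) : Function.update x k 0 ∈ D := by
  have hflip := hsign x hx (fun i => if i = k then -1 else 1) fun i => by
    by_cases h : i = k <;> simp [h]
  convert hconv.midpoint_mem hx hflip using 1
  ext i
  by_cases h : i = k
  · subst h; simp [midpoint_eq_smul_add]
  · simp [h]

/-- Replacing a negative diagonal entry by zero brings a diagonal matrix strictly closer to any
positive semidefinite matrix. -/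
lemma norm_sub_diagonal_update_zero_lt {n : ℕ} {Y : Matrix (Fin n) (Fin n) ℂ}
    (hY : Y.PosSemidef) {d : Fin n → ℝ} {k : Fin n} (hk : d k < 0) :
    ‖Y - Matrix.diagonal (fun i => (Function.update d k 0 i : ℂ))‖ <
      ‖Y - Matrix.diagonal (fun i => (d i : ℂ))‖ := by
  have hkk : ‖Y k k‖ ^ 2 < ‖Y k k - d k‖ ^ 2 := by
    obtain ⟨hre, him⟩ := Complex.nonneg_iff.1 (hY.diag_nonneg (i := k))
    rw [← Complex.normSq_eq_norm_sq, ← Complex.normSq_eq_norm_sq, Complex.normSq_apply,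
      Complex.normSq_apply]
    simp only [Complex.sub_re, Complex.sub_im, Complex.ofReal_re, Complex.ofReal_im]
    nlinarith
  have hle : ∀ i j, ‖(Y - Matrix.diagonal (fun i => (Function.update d k 0 i : ℂ))) i j‖ ^ 2 ≤
      ‖(Y - Matrix.diagonal (fun i => (d i : ℂ))) i j‖ ^ 2 := by
    intro i j
    by_cases hij : i = j
    · subst hij
      by_cases hik : i = k
      · subst hik; simpa using hkk.le
      · simp [hik]
    · simp [hij]
  refine lt_of_pow_lt_pow_left₀ 2 (norm_nonneg _) ?_
  rw [frobenius_norm_sq, frobenius_norm_sq]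
  refine Finset.sum_lt_sum (fun i _ => Finset.sum_le_sum fun j _ => hle i j)
    ⟨k, Finset.mem_univ k, Finset.sum_lt_sum (fun j _ => hle k j) ⟨k, Finset.mem_univ k, ?_⟩⟩
  simpa using hkk

/-- The nearest-point projection (for the Frobenius inner product) of a
positive semidefinite matrix onto a compact convex unitarily invariant spectral set `W` of
Hermitian matrices is positive semidefinite. -/
theorem stmt18 {n : ℕ}
    (W : Set (Matrix (Fin n) (Fin n) ℂ))
    (hWne : W.Nonempty) (hWc : IsCompact W) (hWconv : Convex ℝ W)
    (hWH : ∀ X ∈ W, X.IsHermitian)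
    (hWU : ∀ U ∈ Matrix.unitaryGroup (Fin n) ℂ, ∀ X ∈ W, star U * X * U ∈ W)
    (hWspec : ∃ DW : Set (Fin n → ℝ),
      Convex ℝ DW ∧
      (∀ σ : Equiv.Perm (Fin n), ∀ x ∈ DW, x ∘ σ ∈ DW) ∧
      (∀ x ∈ DW, ∀ s : Fin n → ℝ, (∀ i, s i = 1 ∨ s i = -1) → (fun i => s i * x i) ∈ DW) ∧
      W = {X | ∃ U ∈ Matrix.unitaryGroup (Fin n) ℂ, ∃ dv ∈ DW,
        X = U * Matrix.diagonal (fun i => (dv i : ℂ)) * star U})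
    (X P : Matrix (Fin n) (Fin n) ℂ) (hX : X.PosSemidef)
    (hP : P ∈ W ∧ ∀ Y ∈ W, ‖X - P‖ ≤ ‖X - Y‖) :
    P.PosSemidef := by
  obtain ⟨D, hDconv, -, hDsign, hWD⟩ := hWspec
  obtain ⟨hPW, hmin⟩ := hP
  rw [hWD] at hPW
  obtain ⟨U, hU, d, hd, rfl⟩ := hPW
  have hdist : ∀ e : Fin n → ℝ, ‖X - U * Matrix.diagonal (fun i => (e i : ℂ)) * star U‖ =
      ‖star U * X * U - Matrix.diagonal (fun i => (e i : ℂ))‖ := by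
    intro e
    have hUU : star U * U = 1 := Matrix.mem_unitaryGroup_iff'.1 hU
    rw [← frobenius_norm_unitary_conj hU, mul_sub, sub_mul]
    congr 2
    calc _ = star U * U * Matrix.diagonal (fun i => (e i : ℂ)) * (star U * U) := by
          simp only [mul_assoc]
      _ = _ := by rw [hUU, one_mul, mul_one]
  have hd0 : ∀ k, 0 ≤ d k := by
    intro k
    by_contra! hk
    have hle := hmin _ (hWD.symm.subset
      ⟨U, hU, _, update_zero_mem_of_orthosymmetric hDconv hDsign hd k, rfl⟩)
    rw [hdist, hdist] at hle
    exact hle.not_gt (norm_sub_diagonal_update_zero_lt (hX.conjTranspose_mul_mul_same U) hk)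
  exact (Matrix.PosSemidef.diagonal fun i => by simpa using hd0 i).mul_mul_conjTranspose_same U
end
end
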